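/- For every α-Stieltjes right-nonnegative definite extendable sequence (s_j)_{j=0}^{κ} of complex q×q matrices, the sequence (s_0^{[j,α]})_{j=0}^{κ} of zeroth entries of the iterated α-Schur transforms coincides with the right α-Stieltjes parametrization (Q_j)_{j=0}^{κ} of (s_j)_{j=0}^{κ}. -/

import Mathlib

open Matrix BigOperators ComplexOrder

def IsMP {m n : Type*} [Fintype m] [Fintype n] (A : Matrix m n ℂ) (B : Matrix n m ℂ) : Prop :=
  A * B * A = A ∧ B * A * B = B ∧ (A * B)ᴴ = A * B ∧ (B * A)ᴴ = B * A

open Classical in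
noncomputable def mp {m n : Type*} [Fintype m] [Fintype n] (A : Matrix m n ℂ) : Matrix n m ℂ :=
  if h : ∃ B, IsMP A B then h.choose else 0

noncomputable def recip {p q : ℕ} (s : ℕ → Matrix (Fin p) (Fin q) ℂ) :
    ℕ → Matrix (Fin q) (Fin p) ℂ
  | 0 => mp (s 0)
  | (j+1) => -(mp (s 0) * ∑ l : Fin (j+1), s (j+1 - l.val) * recip s l.val)
termination_by j => j
decreasing_by exact l.isLt

noncomputable def shiftA {p q : ℕ} (α : ℂ) (s : ℕ → Matrix (Fin p) (Fin q) ℂ) :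
    ℕ → Matrix (Fin p) (Fin q) ℂ
  | 0 => s 0
  | (j+1) => (-α) • s j + s (j+1)

noncomputable def recipA {p q : ℕ} (α : ℂ) (s : ℕ → Matrix (Fin p) (Fin q) ℂ) :
    ℕ → Matrix (Fin q) (Fin p) ℂ :=
  recip (shiftA α s)

/-- the first α-Schur transform. -/
noncomputable def schur1 {p q : ℕ} (α : ℂ) (s : ℕ → Matrix (Fin p) (Fin q) ℂ) :
    ℕ → Matrix (Fin p) (Fin q) ℂ :=
  fun j => s 0 * (-(recipA α s (j + 1))) * s 0

/-- block Hankel matrix H_n = [s_{j+k}]_{j,k=0}^{n}. -/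
def hankelMat {p q : ℕ} (s : ℕ → Matrix (Fin p) (Fin q) ℂ) (n : ℕ) :
    Matrix (Fin (n + 1) × Fin p) (Fin (n + 1) × Fin q) ℂ :=
  Matrix.of fun jk lm => s (jk.1.val + lm.1.val) jk.2 lm.2

/-- block Hankel matrix K_n = [s_{j+k+1}]_{j,k=0}^{n}. -/
def hankelKMat {p q : ℕ} (s : ℕ → Matrix (Fin p) (Fin q) ℂ) (n : ℕ) :
    Matrix (Fin (n + 1) × Fin p) (Fin (n + 1) × Fin q) ℂ :=
  Matrix.of fun jk lm => s (jk.1.val + lm.1.val + 1) jk.2 lm.2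

/-- the class K^{≥}_{q,κ,α} of α-Stieltjes right-nonnegative definite sequences. -/
def Kgg {q : ℕ} (α : ℝ) (κ : ℕ∞) (s : ℕ → Matrix (Fin q) (Fin q) ℂ) : Prop :=
  (∀ n : ℕ, ((2 * n : ℕ) : ℕ∞) ≤ κ → (hankelMat s n).PosSemidef) ∧
  (∀ n : ℕ, ((2 * n + 1 : ℕ) : ℕ∞) ≤ κ →
    ((-(α : ℂ)) • hankelMat s n + hankelKMat s n).PosSemidef)

/-- L_k, the Schur complement s_{2k} − z_{k,2k-1} H_{k-1}^+ y_{k,2k-1}. -/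
noncomputable def Lschur {q : ℕ} (s : ℕ → Matrix (Fin q) (Fin q) ℂ) (k : ℕ) :
    Matrix (Fin q) (Fin q) ℂ :=
  s (2 * k) -
    (Matrix.of fun (a : Fin q) (lm : Fin k × Fin q) => s (k + lm.1.val) a lm.2) *
      mp (Matrix.of fun (jm : Fin k × Fin q) (lm : Fin k × Fin q) =>
        s (jm.1.val + lm.1.val) jm.2 lm.2) *
      (Matrix.of fun (jm : Fin k × Fin q) (b : Fin q) => s (k + jm.1.val) jm.2 b)

/-- the right α-Stieltjes parametrization: Q_{2k} = L_k, Q_{2k+1} = L_{α,k}. -/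
noncomputable def stieltjesParam {q : ℕ} (α : ℂ) (s : ℕ → Matrix (Fin q) (Fin q) ℂ) :
    ℕ → Matrix (Fin q) (Fin q) ℂ :=
  fun j =>
    if Even j then Lschur s (j / 2)
    else Lschur (fun i => (-α) • s i + s (i + 1)) (j / 2)

/-- the class K^{≥,e}_{q,κ,α} of α-Stieltjes right-nonnegative definite extendable
    sequences: every truncation extends by one matrix to a member of K^{≥}. -/
def KggE {q : ℕ} (α : ℝ) (κ : ℕ∞) (s : ℕ → Matrix (Fin q) (Fin q) ℂ) : Prop :=
  ∀ m : ℕ, (m : ℕ∞) ≤ κ → ∃ t : ℕ → Matrix (Fin q) (Fin q) ℂ,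
    (∀ j : ℕ, j ≤ m → t j = s j) ∧ Kgg α ((m + 1 : ℕ) : ℕ∞) t

section MoorePenrose

variable {n m : Type*} [Fintype n] [Fintype m]

lemma IsMP.unique {A : Matrix m n ℂ} {B C : Matrix n m ℂ} (hB : IsMP A B) (hC : IsMP A C) :
    B = C := by
  obtain ⟨b1, b2, b3, b4⟩ := hB
  obtain ⟨c1, c2, c3, c4⟩ := hC
  have h1 : A * B = A * C := by
    calc A * B = (A * B)ᴴ := b3.symm
      _ = ((A * C) * (A * B))ᴴ := by rw [← Matrix.mul_assoc, c1]
      _ = (A * B) * (A * C) := by rw [conjTranspose_mul, b3, c3]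
      _ = A * C := by rw [← Matrix.mul_assoc, b1]
  have h2 : B * A = C * A := by
    calc B * A = (B * A)ᴴ := b4.symm
      _ = ((B * A) * (C * A))ᴴ := by rw [Matrix.mul_assoc, ← Matrix.mul_assoc A, c1]
      _ = (C * A) * (B * A) := by rw [conjTranspose_mul, b4, c4]
      _ = C * A := by rw [Matrix.mul_assoc, ← Matrix.mul_assoc A, b1]
  calc B = B * A * B := b2.symm
    _ = C * A * B := by rw [h2]
    _ = C * (A * C) := by rw [Matrix.mul_assoc, h1]
    _ = C := by rw [← Matrix.mul_assoc, c2]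

lemma exists_isMP_of_isHermitian {A : Matrix n n ℂ} (hA : A.IsHermitian) :
    ∃ B : Matrix n n ℂ, IsMP A B ∧ Bᴴ = B ∧ A * B = B * A := by
  classical
  have hsa : IsSelfAdjoint A := hA
  have hfin : (spectrum ℝ A).Finite := Matrix.finite_real_spectrum
  have hc : ∀ f : ℝ → ℝ, ContinuousOn f (spectrum ℝ A) := fun f => hfin.continuousOn f
  set B := cfc (fun x : ℝ => x⁻¹) A with hBdef
  have hB : Bᴴ = B := (cfc_predicate (R := ℝ) (fun x : ℝ => x⁻¹) A : IsSelfAdjoint _)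
  have hAid : cfc (fun x : ℝ => x) A = A := cfc_id' ℝ A
  have hAB : A * B = cfc (fun x : ℝ => x * x⁻¹) A := by
    rw [cfc_mul (fun x : ℝ => x) (fun x : ℝ => x⁻¹) A (hc _) (hc _), hAid]
  have hBA : B * A = cfc (fun x : ℝ => x * x⁻¹) A := by
    have : (fun x : ℝ => x * x⁻¹) = fun x => x⁻¹ * x := by ext x; ring
    rw [this, cfc_mul (fun x : ℝ => x⁻¹) (fun x : ℝ => x) A (hc _) (hc _), hAid]
  have hcomm : A * B = B * A := hAB.trans hBA.symm
  have hABsa : (A * B)ᴴ = A * B := by rw [conjTranspose_mul, hB, hA.eq, hcomm]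
  refine ⟨B, ⟨?_, ?_, hABsa, by rw [← hcomm, hABsa]⟩, hB, hcomm⟩
  · conv_lhs => rw [hAB]
    nth_rewrite 2 [← hAid]
    rw [← cfc_mul _ _ A (hc _) (hc _)]
    simp [hAid]
  · rw [hBA, hBdef, ← cfc_mul _ _ A (hc _) (hc _)]
    congr 1
    ext x
    by_cases hx : x = 0 <;> simp [hx]

lemma isMP_mp {A : Matrix n n ℂ} (hA : A.IsHermitian) : IsMP A (mp A) := by
  obtain ⟨B, hB, -⟩ := exists_isMP_of_isHermitian hA
  have h : ∃ B, IsMP A B := ⟨B, hB⟩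
  rw [mp, dif_pos h]
  exact h.choose_spec

lemma conjTranspose_mp {A : Matrix n n ℂ} (hA : A.IsHermitian) : (mp A)ᴴ = mp A := by
  obtain ⟨B, hB, h, -⟩ := exists_isMP_of_isHermitian hA
  rw [(isMP_mp hA).unique hB, h]

lemma mul_mp_comm {A : Matrix n n ℂ} (hA : A.IsHermitian) : A * mp A = mp A * A := by
  obtain ⟨B, hB, -, h⟩ := exists_isMP_of_isHermitian hA
  rw [(isMP_mp hA).unique hB, h]

end MoorePenrose

lemma Matrix.PosSemidef.mul_eq_zero_of_conjTranspose_mul_mul {n m : Type*} [Fintype n]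
    {H : Matrix n n ℂ}
    (hH : H.PosSemidef) (E : Matrix n m ℂ) (h : Eᴴ * H * E = 0) : H * E = 0 := by
  ext i y
  have h0 : H *ᵥ (fun x => E x y) = 0 := by
    rw [← hH.dotProduct_mulVec_zero_iff]
    have := congrFun (congrFun h y) y
    rw [Matrix.mul_assoc, mul_apply] at this
    exact this
  exact congrFun h0 i

lemma Matrix.PosSemidef.submatrix_mul_eq_zero {n m l : Type*} [Fintype n] [Fintype m]
    {H : Matrix n n ℂ} (hH : H.PosSemidef) (f : m → n) (X : Matrix m l ℂ)
    (h : H.submatrix f f * X = 0) : H.submatrix id f * X = 0 := by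
  classical
  have key : H * ((1 : Matrix n n ℂ).submatrix id f) = H.submatrix id f := by
    ext i j; simp [mul_apply, one_apply]
  have key2 : ((1 : Matrix n n ℂ).submatrix id f)ᴴ * H.submatrix id f = H.submatrix f f := by
    ext i j; simp [mul_apply, one_apply]
  have := hH.mul_eq_zero_of_conjTranspose_mul_mul ((1 : Matrix n n ℂ).submatrix id f * X) (by
    rw [Matrix.mul_assoc, ← Matrix.mul_assoc H, key, conjTranspose_mul, Matrix.mul_assoc,
      ← Matrix.mul_assoc _ _ X, key2, h, Matrix.mul_zero])
  rwa [← Matrix.mul_assoc, key] at this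

section BlockMatrices

variable {q : ℕ}

/-- The block matrix `[h j k]` with `n` block rows and `m` block columns. -/
def blockMat (n m : ℕ) (h : ℕ → ℕ → Matrix (Fin q) (Fin q) ℂ) :
    Matrix (Fin n × Fin q) (Fin m × Fin q) ℂ :=
  Matrix.of fun i j => h i.1 j.1 i.2 j.2

lemma blockMat_mul (n m l : ℕ) (f g : ℕ → ℕ → Matrix (Fin q) (Fin q) ℂ) :
    blockMat n m f * blockMat m l g =
      blockMat n l fun j k => ∑ i ∈ Finset.range m, f j i * g i k := by
  ext a b
  simp only [blockMat, mul_apply, of_apply, Matrix.sum_apply, Fintype.sum_prod_type,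
    Finset.sum_range]

lemma conjTranspose_blockMat (n m : ℕ) (f : ℕ → ℕ → Matrix (Fin q) (Fin q) ℂ) :
    (blockMat n m f)ᴴ = blockMat m n fun j k => (f k j)ᴴ := rfl

lemma blockMat_congr {n m : ℕ} {f g : ℕ → ℕ → Matrix (Fin q) (Fin q) ℂ}
    (h : ∀ j < n, ∀ k < m, f j k = g j k) : blockMat n m f = blockMat n m g := by
  ext a b
  simp only [blockMat, of_apply]
  rw [h _ a.1.isLt _ b.1.isLt]

lemma blockMat_apply_eq {n m : ℕ} {f g : ℕ → ℕ → Matrix (Fin q) (Fin q) ℂ}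
    (h : blockMat n m f = blockMat n m g) {j k : ℕ} (hj : j < n) (hk : k < m) :
    f j k = g j k := by
  ext x y
  exact congrFun (congrFun h (⟨j, hj⟩, x)) (⟨k, hk⟩, y)

/-- The kernel of the block lower triangular Toeplitz matrix with first column `u`. -/
def lowerToeplitz (u : ℕ → Matrix (Fin q) (Fin q) ℂ) (j l : ℕ) : Matrix (Fin q) (Fin q) ℂ :=
  if l ≤ j then u (j - l) else 0

lemma sum_lowerToeplitz_mul (u f : ℕ → Matrix (Fin q) (Fin q) ℂ) {j n : ℕ} (hj : j < n) :
    ∑ l ∈ Finset.range n, lowerToeplitz u j l * f l =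
      ∑ l ∈ Finset.range (j + 1), u (j - l) * f l := by
  symm
  apply Finset.sum_subset_zero_on_sdiff (Finset.range_mono hj)
  · intro l hl
    simp only [Finset.mem_sdiff, Finset.mem_range, not_lt] at hl
    rw [lowerToeplitz, if_neg (by omega), Matrix.zero_mul]
  · intro l hl
    rw [lowerToeplitz, if_pos (by simpa [Nat.lt_succ_iff] using hl)]

lemma sum_mul_conjTranspose_lowerToeplitz (u f : ℕ → Matrix (Fin q) (Fin q) ℂ) {k n : ℕ}
    (hk : k < n) :
    ∑ l ∈ Finset.range n, f l * (lowerToeplitz u k l)ᴴ =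
      ∑ l ∈ Finset.range (k + 1), f l * (u (k - l))ᴴ := by
  have := congrArg conjTranspose (sum_lowerToeplitz_mul u (fun l => (f l)ᴴ) hk)
  simpa [conjTranspose_sum] using this

lemma isUnit_blockMat_lowerToeplitz (u : ℕ → Matrix (Fin q) (Fin q) ℂ) (hu : u 0 = 1) (n : ℕ) :
    IsUnit (blockMat n n (lowerToeplitz u)) := by
  rw [← Matrix.isUnit_conjTranspose, Matrix.isUnit_iff_isUnit_det]
  have ht : (blockMat n n (lowerToeplitz u))ᴴ.BlockTriangular Prod.fst := by
    intro i j hij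
    have : ¬ (i.1 ≤ j.1) := not_le.mpr hij
    simp [blockMat, lowerToeplitz, this]
  rw [ht.det_fintype, Finset.prod_eq_one]
  · exact isUnit_one
  · intro k _
    suffices h : (blockMat n n (lowerToeplitz u))ᴴ.toSquareBlock Prod.fst k = 1 by
      rw [h, Matrix.det_one]
    ext ⟨⟨i, x⟩, hi⟩ ⟨⟨j, y⟩, hj⟩
    obtain rfl : i = k := hi
    obtain rfl : j = i := hj
    simp only [toSquareBlock_def, conjTranspose_apply, blockMat, of_apply, lowerToeplitz,
      le_refl, if_true, Nat.sub_self, hu, one_apply, Subtype.mk.injEq, Prod.mk.injEq, true_and]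
    by_cases h : x = y
    · simp [h]
    · simp [h, Ne.symm h]

/-- A convolution congruence `∑ u (j - l) c (l + m) (u (k - m))ᴴ` of a Hankel kernel is determined
by its displacement and its first column. -/
lemma toeplitz_hankel_congruence (u c : ℕ → Matrix (Fin q) (Fin q) ℂ) (hu : u 0 = 1)
    (hc : ∀ j, (c j)ᴴ = c j) (a : ℕ → Matrix (Fin q) (Fin q) ℂ)
    (ha : ∀ j, ∑ l ∈ Finset.range (j + 1), u (j - l) * c l = a j)
    (Y : ℕ → ℕ → Matrix (Fin q) (Fin q) ℂ) (hY0 : ∀ j, Y j 0 = a j)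
    (hY : ∀ j k, Y (j + 1) k + a j * (u (k + 1))ᴴ = Y j (k + 1) + u (j + 1) * (a k)ᴴ) (j k : ℕ) :
    ∑ m ∈ Finset.range (k + 1), (∑ l ∈ Finset.range (j + 1), u (j - l) * c (l + m)) *
      (u (k - m))ᴴ = Y j k := by
  have hR : ∀ k, ∑ m ∈ Finset.range (k + 1), c m * (u (k - m))ᴴ = (a k)ᴴ := by
    intro k
    rw [← ha, conjTranspose_sum]
    exact Finset.sum_congr rfl fun l _ => by rw [conjTranspose_mul, hc]
  induction k generalizing j with
  | zero => simp [hu, ha, hY0]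
  | succ k ih =>
    have h1 := ih (j + 1)
    have h2 : ∀ m, ∑ l ∈ Finset.range (j + 1 + 1), u (j + 1 - l) * c (l + m) =
        ∑ l ∈ Finset.range (j + 1), u (j - l) * c (l + (m + 1)) + u (j + 1) * c m := by
      intro m
      rw [Finset.sum_range_succ']
      simp [Nat.add_sub_add_right, add_assoc, add_comm 1 m]
    simp only [h2, Matrix.add_mul, Finset.sum_add_distrib, Matrix.mul_assoc,
      ← Finset.mul_sum, hR] at h1
    rw [Finset.sum_range_succ']
    simp only [Nat.add_sub_add_right, add_zero, ha, Nat.sub_zero]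
    have := hY j k
    rw [← h1] at this
    have h3 := add_right_cancel (b := u (j + 1) * (a k)ᴴ)
      (a := ∑ m ∈ Finset.range (k + 1), (∑ l ∈ Finset.range (j + 1), u (j - l) * c (l + (m + 1))) *
      (u (k - m))ᴴ + a j * (u (k + 1))ᴴ) (c := Y j (k + 1)) (by
        rw [← this]; abel)
    exact h3

lemma toeplitz_hankel_blockMat {u c : ℕ → Matrix (Fin q) (Fin q) ℂ}
    {Y : ℕ → ℕ → Matrix (Fin q) (Fin q) ℂ}
    (h : ∀ j k, ∑ m ∈ Finset.range (k + 1), (∑ l ∈ Finset.range (j + 1), u (j - l) * c (l + m)) *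
      (u (k - m))ᴴ = Y j k) (n : ℕ) :
    blockMat n n (lowerToeplitz u) * blockMat n n (fun j k => c (j + k)) *
      (blockMat n n (lowerToeplitz u))ᴴ = blockMat n n Y := by
  rw [conjTranspose_blockMat, blockMat_mul, blockMat_mul]
  apply blockMat_congr
  intro j hj k hk
  rw [sum_mul_conjTranspose_lowerToeplitz u _ hk, ← h]
  exact Finset.sum_congr rfl fun m _ => by
    rw [sum_lowerToeplitz_mul u (fun l => c (l + m)) hj]

/-- `L` is a Schur complement of the last diagonal block of `[h j m]_{j,m ≤ k}`, witnessed by a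
block column with last entry `1` that is mapped to the block column with the single entry `L`. -/
def IsLastSchur (h : ℕ → ℕ → Matrix (Fin q) (Fin q) ℂ) (k : ℕ)
    (L : Matrix (Fin q) (Fin q) ℂ) : Prop :=
  ∃ v : ℕ → Matrix (Fin q) (Fin q) ℂ, v k = 1 ∧
    ∀ j ≤ k, ∑ m ∈ Finset.range (k + 1), h j m * v m = if j = k then L else 0

lemma IsLastSchur.of_congruence {u c : ℕ → Matrix (Fin q) (Fin q) ℂ} (hu : u 0 = 1)
    {Y : ℕ → ℕ → Matrix (Fin q) (Fin q) ℂ}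
    (h : ∀ j k, ∑ m ∈ Finset.range (k + 1), (∑ l ∈ Finset.range (j + 1), u (j - l) * c (l + m)) *
      (u (k - m))ᴴ = Y j k) {k : ℕ} {L : Matrix (Fin q) (Fin q) ℂ}
    (hL : IsLastSchur Y k L) : IsLastSchur (fun j m => c (j + m)) k L := by
  obtain ⟨v, hv, hvL⟩ := hL
  refine ⟨fun p => ∑ m ∈ Finset.range (k + 1), (lowerToeplitz u m p)ᴴ * v m, ?_, ?_⟩
  · beta_reduce
    rw [Finset.sum_range_succ, Finset.sum_eq_zero]
    · simp [lowerToeplitz, hu, hv]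
    · intro m hm
      have : ¬ k ≤ m := by simpa using hm
      simp [lowerToeplitz, this]
  · set y : ℕ → Matrix (Fin q) (Fin q) ℂ := fun j => ∑ p ∈ Finset.range (k + 1), c (j + p) *
      ∑ m ∈ Finset.range (k + 1), (lowerToeplitz u m p)ᴴ * v m with hy
    have key : ∀ j ≤ k, ∑ l ∈ Finset.range (j + 1), u (j - l) * y l = if j = k then L else 0 := by
      intro j hj
      rw [← hvL j hj]
      have : ∀ m ∈ Finset.range (k + 1), Y j m * v m = ∑ p ∈ Finset.range (k + 1),
          ∑ l ∈ Finset.range (j + 1), u (j - l) * (c (l + p) * ((lowerToeplitz u m p)ᴴ * v m)) := by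
        intro m hm
        rw [← h, ← sum_mul_conjTranspose_lowerToeplitz u
          (fun m => ∑ l ∈ Finset.range (j + 1), u (j - l) * c (l + m)) (Finset.mem_range.mp hm)]
        simp only [Finset.sum_mul, Matrix.mul_assoc]
      rw [Finset.sum_congr rfl this]
      simp only [hy, Finset.mul_sum]
      exact (Finset.sum_comm.trans (Finset.sum_congr rfl fun p _ => Finset.sum_comm)).trans
        Finset.sum_comm
    change ∀ j ≤ k, y j = if j = k then L else 0
    intro j
    induction j using Nat.strong_induction_on with
    | _ j ih =>
      intro hj
      rw [← key j hj, Finset.sum_range_succ, Finset.sum_eq_zero]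
      · simp [hu]
      · intro l hl
        have hl : l < j := by simpa using hl
        rw [ih l hl (by omega), if_neg (by omega), Matrix.mul_zero]

end BlockMatrices

section SchurComplement

variable {q : ℕ}

private lemma mul_blockColumn {k : ℕ} {p : Type*} (R : Matrix p (Fin k × Fin q) ℂ)
    (v : ℕ → Matrix (Fin q) (Fin q) ℂ) :
    R * (Matrix.of fun (jm : Fin k × Fin q) (b : Fin q) => v jm.1.val jm.2 b) =
      ∑ i : Fin k, (Matrix.of fun a x => R a (i, x)) * v i := by
  ext a b
  simp [mul_apply, Matrix.sum_apply, Fintype.sum_prod_type]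

lemma IsLastSchur.eq_Lschur {c : ℕ → Matrix (Fin q) (Fin q) ℂ} (hc : ∀ j, (c j)ᴴ = c j) {k : ℕ}
    {L : Matrix (Fin q) (Fin q) ℂ} (h : IsLastSchur (fun j m => c (j + m)) k L) :
    L = Lschur c k := by
  obtain ⟨v, hv, hL⟩ := h
  rw [Lschur]
  set Z := (Matrix.of fun (a : Fin q) (lm : Fin k × Fin q) => c (k + lm.1.val) a lm.2) with hZ
  set M := (Matrix.of fun (jm : Fin k × Fin q) (lm : Fin k × Fin q) =>
        c (jm.1.val + lm.1.val) jm.2 lm.2) with hM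
  set Y := (Matrix.of fun (jm : Fin k × Fin q) (b : Fin q) => c (k + jm.1.val) jm.2 b) with hY
  set C := (Matrix.of fun (jm : Fin k × Fin q) (b : Fin q) => v jm.1.val jm.2 b) with hC
  have hYZ : Yᴴ = Z := by
    ext a ⟨i, x⟩
    exact congrFun (congrFun (hc (k + i)) a) x
  have hMh : Mᴴ = M := by
    ext ⟨j, a⟩ ⟨i, x⟩
    have := congrFun (congrFun (hc (j + i)) a) x
    simpa [hM, add_comm] using this
  have hMC : M * C = -Y := by
    ext ⟨j, a⟩ b
    have h1 := hL j j.isLt.le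
    rw [Finset.sum_range_succ, if_neg j.isLt.ne, hv, Matrix.mul_one, Finset.sum_range] at h1
    have h2 := congrFun (congrFun (eq_neg_of_add_eq_zero_left h1) a) b
    simp only [Matrix.sum_apply, mul_apply] at h2
    simp only [hM, hC, hY, mul_apply, of_apply, Fintype.sum_prod_type, Matrix.neg_apply, h2]
    rw [add_comm]
    rfl
  have hZC : L = c (2 * k) + Z * C := by
    have h1 := hL k le_rfl
    rw [Finset.sum_range_succ, if_pos rfl, hv, Matrix.mul_one, Finset.sum_range] at h1
    rw [← h1, hC, mul_blockColumn, add_comm, two_mul]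
    rfl
  have hY' : Y = -(M * C) := by rw [hMC, neg_neg]
  have : Z * mp M * Y = -(Z * C) := by
    rw [← hYZ, hY', conjTranspose_neg, conjTranspose_mul, hMh]
    simp only [Matrix.neg_mul, Matrix.mul_neg, neg_neg]
    have h1 := (isMP_mp hMh).1
    calc Cᴴ * M * mp M * (M * C) = Cᴴ * (M * mp M * M) * C := by simp only [Matrix.mul_assoc]
      _ = Cᴴ * M * C := by rw [h1]
  rw [hZC, this, sub_neg_eq_add]

lemma isLastSchur_Lschur {c : ℕ → Matrix (Fin q) (Fin q) ℂ} {k : ℕ}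
    (hH : (hankelMat c k).PosSemidef) : IsLastSchur (fun j m => c (j + m)) k (Lschur c k) := by
  set Z := (Matrix.of fun (a : Fin q) (lm : Fin k × Fin q) => c (k + lm.1.val) a lm.2) with hZ
  set M := (Matrix.of fun (jm : Fin k × Fin q) (lm : Fin k × Fin q) =>
        c (jm.1.val + lm.1.val) jm.2 lm.2) with hM
  set Y := (Matrix.of fun (jm : Fin k × Fin q) (b : Fin q) => c (k + jm.1.val) jm.2 b) with hY
  let f : Fin k × Fin q → Fin (k + 1) × Fin q := fun i => (i.1.castSucc, i.2)
  have hMf : (hankelMat c k).submatrix f f = M := rfl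
  have hMh : Mᴴ = M := (hH.submatrix f).isHermitian
  have hYZ : Yᴴ = Z := by
    ext a ⟨i, x⟩
    have := congrFun (congrFun hH.isHermitian.eq (Fin.last k, a)) (i.castSucc, x)
    simpa [hankelMat, hY, hZ, add_comm] using this
  obtain ⟨h1, -, -, -⟩ := isMP_mp hMh
  have hZM : Z * mp M * M = Z := by
    classical
    have h2 := hH.submatrix_mul_eq_zero f (1 - mp M * M) (by
      rw [hMf, Matrix.mul_sub, Matrix.mul_one, ← Matrix.mul_assoc, h1, sub_self])
    have h3 : Z * (1 - mp M * M) = 0 := by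
      ext a b
      exact congrFun (congrFun h2 (Fin.last k, a)) b
    rw [Matrix.mul_sub, Matrix.mul_one, sub_eq_zero, ← Matrix.mul_assoc] at h3
    exact h3.symm
  have hMY : M * mp M * Y = Y := by
    have := congrArg conjTranspose hZM
    rwa [conjTranspose_mul, conjTranspose_mul, conjTranspose_mp hMh, hMh, ← hYZ,
      conjTranspose_conjTranspose, ← Matrix.mul_assoc] at this
  refine ⟨fun m => if h : m < k then -(Matrix.of fun a b => (mp M * Y) (⟨m, h⟩, a) b) else 1,
    by simp, ?_⟩
  intro j hj
  rw [Finset.sum_range_succ, Finset.sum_range]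
  simp only [Fin.is_lt, dite_true, lt_irrefl, dite_false, Matrix.mul_one]
  split_ifs with h
  · subst h
    rw [Lschur, ← hZ, ← hM, ← hY, Matrix.mul_assoc]
    ext a b
    rw [Matrix.sub_apply, mul_apply, Fintype.sum_prod_type, sub_eq_neg_add]
    simp [Matrix.sum_apply, hZ, two_mul, mul_apply (M := c _)]
  · have hjk : j < k := by omega
    ext a b
    have h4 := congrFun (congrFun hMY (⟨j, hjk⟩, a)) b
    rw [Matrix.mul_assoc, mul_apply] at h4
    simp [Fintype.sum_prod_type] at h4
    simp [Matrix.sum_apply, mul_apply (M := c _)]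
    rw [neg_add_eq_zero]
    simp only [hM, hY, of_apply] at h4 ⊢
    rw [add_comm j k]
    exact h4

/-- Eliminating the first block row and column keeps the last Schur complement. -/
lemma IsLastSchur.eliminate {c : ℕ → Matrix (Fin q) (Fin q) ℂ} {k : ℕ}
    {L W : Matrix (Fin q) (Fin q) ℂ} (hW : ∀ j, c j * W * c 0 = c j)
    (h : IsLastSchur (fun j m => c (j + m)) (k + 1) L) :
    IsLastSchur (fun j m => c (j + m + 2) - c (j + 1) * W * c (m + 1)) k L := by
  obtain ⟨v, hv, hL⟩ := h
  refine ⟨fun m => v (m + 1), hv, fun j hj => ?_⟩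
  have h0 := hL 0 (by omega)
  have h1 := hL (j + 1) (by omega)
  rw [Finset.sum_range_succ'] at h0 h1
  simp only [zero_add, add_zero, Nat.add_right_cancel_iff] at h0 h1
  rw [if_neg (by omega)] at h0
  have h2 := congrArg (fun x => c (j + 1) * W * x) h0
  simp only [Matrix.mul_add, Matrix.mul_zero, ← Matrix.mul_assoc, hW, Finset.mul_sum] at h2
  rw [← h1, ← sub_zero (∑ i ∈ Finset.range (k + 1), c (j + 1 + (i + 1)) * v (i + 1) + _), ← h2]
  simp only [Matrix.sub_mul, Finset.sum_sub_distrib, add_sub_add_right_eq_sub]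
  congr 1
  exact Finset.sum_congr rfl fun m _ => by rw [show j + m + 2 = j + 1 + (m + 1) by ring]

end SchurComplement

section DominatedSequences

variable {q : ℕ}

/-- A sequence of Hermitian matrices whose ranges are contained in the range of the first one. -/
structure IsDominated (s : ℕ → Matrix (Fin q) (Fin q) ℂ) : Prop where
  herm : ∀ j, (s j)ᴴ = s j
  dom : ∀ j, s 0 * mp (s 0) * s j = s j

namespace IsDominated

variable {s : ℕ → Matrix (Fin q) (Fin q) ℂ}

lemma mul_mp_mul (hs : IsDominated s) : s 0 * mp (s 0) * s 0 = s 0 := hs.dom 0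

lemma dom_right (hs : IsDominated s) (j : ℕ) : s j * mp (s 0) * s 0 = s j := by
  have := congrArg conjTranspose (hs.dom j)
  rwa [conjTranspose_mul, conjTranspose_mul, conjTranspose_mp (hs.herm 0), hs.herm, hs.herm,
    ← Matrix.mul_assoc] at this

lemma isDominated_shiftA (hs : IsDominated s) (α : ℝ) : IsDominated (shiftA (α : ℂ) s) where
  herm j := by
    cases j with
    | zero => exact hs.herm 0
    | succ j => simp [shiftA, hs.herm]
  dom j := by
    cases j with
    | zero => exact hs.dom 0
    | succ j =>
      simp only [shiftA, Matrix.mul_add, Matrix.mul_smul, hs.dom]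

lemma recip_zero (s : ℕ → Matrix (Fin q) (Fin q) ℂ) : recip s 0 = mp (s 0) := by
  rw [recip]

lemma recip_succ (s : ℕ → Matrix (Fin q) (Fin q) ℂ) (j : ℕ) :
    recip s (j + 1) =
      -(mp (s 0) * ∑ l ∈ Finset.range (j + 1), s (j + 1 - l) * recip s l) := by
  rw [recip, Fin.sum_univ_eq_sum_range (fun l => s (j + 1 - l) * recip s l) (j + 1)]

lemma proj_mul_recip (hs : IsDominated s) (j : ℕ) : s 0 * mp (s 0) * recip s j = recip s j := by
  have h : s 0 * mp (s 0) * mp (s 0) = mp (s 0) := by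
    rw [mul_mp_comm (hs.herm 0), (isMP_mp (hs.herm 0)).2.1]
  cases j with
  | zero => rw [recip_zero, h]
  | succ j => rw [recip_succ, Matrix.mul_neg, ← Matrix.mul_assoc, h]

lemma sum_mul_recip (hs : IsDominated s) (j : ℕ) :
    ∑ l ∈ Finset.range (j + 1), s (j - l) * recip s l =
      if j = 0 then s 0 * mp (s 0) else 0 := by
  cases j with
  | zero => simp [recip_zero]
  | succ j =>
    rw [Finset.sum_range_succ, Nat.sub_self, recip_succ, Matrix.mul_neg, ← Matrix.mul_assoc,
      Finset.mul_sum]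
    simp only [← Matrix.mul_assoc, hs.dom]
    simp

open PowerSeries in
lemma conjTranspose_recip (hs : IsDominated s) (j : ℕ) : (recip s j)ᴴ = recip s j := by
  set P := s 0 * mp (s 0) with hP
  have hPh : Pᴴ = P := (isMP_mp (hs.herm 0)).2.2.1
  have h1 : PowerSeries.mk s * PowerSeries.mk (recip s) = C P := by
    ext1 j
    rw [coeff_mul, ← Finset.Nat.sum_antidiagonal_swap]
    simp only [Prod.fst_swap, Prod.snd_swap, coeff_mk, coeff_C]
    rw [Finset.Nat.sum_antidiagonal_eq_sum_range_succ (fun l i => s i * recip s l),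
      hs.sum_mul_recip]
  have h2 : PowerSeries.mk (fun j => (recip s j)ᴴ) * PowerSeries.mk s = C P := by
    ext1 j
    rw [coeff_mul]
    simp only [coeff_mk, coeff_C]
    rw [Finset.Nat.sum_antidiagonal_eq_sum_range_succ (fun l i => (recip s l)ᴴ * s i)]
    have := congrArg conjTranspose (hs.sum_mul_recip j)
    rw [conjTranspose_sum] at this
    simp only [conjTranspose_mul, hs.herm] at this
    rw [this]
    split_ifs
    · exact hPh
    · simp
  have h3 : C P * PowerSeries.mk (recip s) = PowerSeries.mk (recip s) := by
    ext1 j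
    rw [coeff_C_mul, coeff_mk, hs.proj_mul_recip]
  have h4 : PowerSeries.mk (fun j => (recip s j)ᴴ) * C P =
      PowerSeries.mk (fun j => (recip s j)ᴴ) := by
    ext1 j
    rw [coeff_mul_C, coeff_mk]
    nth_rewrite 1 [← hPh]
    rw [← conjTranspose_mul, hs.proj_mul_recip]
  have h5 := congrArg (coeff j) (mul_assoc (PowerSeries.mk (fun j => (recip s j)ᴴ))
    (PowerSeries.mk s) (PowerSeries.mk (recip s)))
  rw [h1, h2, h3, h4] at h5
  simpa using h5.symm

lemma conjTranspose_schur1 (hs : IsDominated s) (α : ℝ) (j : ℕ) :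
    (schur1 (α : ℂ) s j)ᴴ = schur1 (α : ℂ) s j := by
  simp only [schur1, recipA, conjTranspose_mul, conjTranspose_neg,
    (hs.isDominated_shiftA α).conjTranspose_recip, hs.herm, Matrix.mul_assoc]

lemma proj_mul_schur1 (hs : IsDominated s) (α : ℂ) (j : ℕ) :
    s 0 * mp (s 0) * schur1 α s j = schur1 α s j := by
  simp only [schur1, ← Matrix.mul_assoc, hs.mul_mp_mul]

lemma sum_shiftA_mul_schur1 (hs : IsDominated s) (α : ℝ) (j : ℕ) :
    ∑ l ∈ Finset.range (j + 1), shiftA (α : ℂ) s (j - l) * mp (s 0) *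
      schur1 (α : ℂ) s l = shiftA (α : ℂ) s (j + 1) := by
  have hA := hs.isDominated_shiftA α
  have h0 : shiftA (α : ℂ) s 0 = s 0 := rfl
  have h := hA.sum_mul_recip (j + 1)
  rw [Finset.sum_range_succ', if_neg (by omega)] at h
  simp only [Nat.add_sub_add_right, Nat.sub_zero, recip_zero, h0] at h
  have h' := congrArg (· * s 0) (eq_neg_of_add_eq_zero_left h)
  have hr := hA.dom_right (j + 1)
  rw [h0] at hr
  simp only [Finset.sum_mul, Matrix.neg_mul, hr] at h'
  rw [← neg_eq_iff_eq_neg.mpr h', ← Finset.sum_neg_distrib]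
  refine Finset.sum_congr rfl fun l _ => ?_
  have hl := hA.dom_right (j - l)
  rw [h0] at hl
  rw [schur1, ← Matrix.mul_assoc, ← Matrix.mul_assoc, hl]
  simp [recipA]

lemma sum_mul_shifted_schur1 (hs : IsDominated s) (α : ℝ) (j : ℕ) :
    ∑ l ∈ Finset.range (j + 1), s (j - l) * mp (s 0) *
      ((-(α : ℂ)) • schur1 (α : ℂ) s l + schur1 (α : ℂ) s (l + 1)) =
      s (j + 2) - s (j + 1) * mp (s 0) * s 1 := by
  set G := schur1 (α : ℂ) s with hG
  have hG0 : G 0 = (-(α : ℂ)) • s 0 + s 1 := by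
    have := hs.sum_shiftA_mul_schur1 α 0
    simp only [zero_add, Finset.sum_range_one, Nat.sub_zero] at this
    rw [hG, ← hs.proj_mul_schur1]
    exact this
  have h1 := hs.sum_shiftA_mul_schur1 α (j + 1)
  have h2 : ∑ l ∈ Finset.range (j + 1 + 1), s (j + 1 - l) * mp (s 0) * G l =
      ∑ l ∈ Finset.range (j + 1), s (j - l) * mp (s 0) * G (l + 1) +
        s (j + 1) * mp (s 0) * G 0 := by
    rw [Finset.sum_range_succ']
    simp only [Nat.add_sub_add_right, Nat.sub_zero]
  rw [Finset.sum_range_succ] at h2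
  have h3 : ∀ l ∈ Finset.range (j + 1), shiftA (α : ℂ) s (j + 1 - l) =
      (-(α : ℂ)) • s (j - l) + s (j + 1 - l) := by
    intro l hl
    have : j + 1 - l = j - l + 1 := by
      have := Finset.mem_range.mp hl
      omega
    rw [this]
    rfl
  rw [Finset.sum_range_succ, ← hG, Finset.sum_congr rfl (fun l hl => by rw [h3 l hl])] at h1
  simp only [Nat.sub_self, Matrix.add_mul, Finset.sum_add_distrib, add_assoc] at h1 h2
  rw [show shiftA (α : ℂ) s 0 = s 0 from rfl, h2, hG0] at h1
  simp only [Matrix.mul_add, Matrix.mul_smul, Matrix.smul_mul, hs.dom_right, shiftA] at h1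
  simp only [Matrix.mul_add, Matrix.mul_smul, Finset.sum_add_distrib]
  rw [eq_sub_iff_add_eq]
  have h4 : (-(α : ℂ)) • s (j + 1) + s (j + 2) = s (j + 2) + (-(α : ℂ)) • s (j + 1) := add_comm _ _
  rw [show j + 1 + 1 = j + 2 from rfl, h4] at h1
  apply add_right_cancel (b := (-(α : ℂ)) • s (j + 1))
  rw [← h1]
  abel

end IsDominated

/-- The sequence `x j * W` with its zeroth entry replaced by the identity. -/
noncomputable def unitCoeff (x : ℕ → Matrix (Fin q) (Fin q) ℂ) (W : Matrix (Fin q) (Fin q) ℂ)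
    (j : ℕ) : Matrix (Fin q) (Fin q) ℂ :=
  if j = 0 then 1 else x j * W

lemma unitCoeff_mul {x : ℕ → Matrix (Fin q) (Fin q) ℂ} {W c : Matrix (Fin q) (Fin q) ℂ}
    (h : x 0 * W * c = c) (j : ℕ) : unitCoeff x W j * c = x j * W * c := by
  rw [unitCoeff]
  split_ifs with hj
  · rw [hj, h, Matrix.one_mul]
  · rfl

namespace IsDominated

variable {s : ℕ → Matrix (Fin q) (Fin q) ℂ}

lemma congruence_schur1 (hs : IsDominated s) (α : ℝ) (j k : ℕ) :
    ∑ m ∈ Finset.range (k + 1), (∑ l ∈ Finset.range (j + 1),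
      unitCoeff (shiftA (α : ℂ) s) (mp (s 0)) (j - l) * schur1 (α : ℂ) s (l + m)) *
      (unitCoeff (shiftA (α : ℂ) s) (mp (s 0)) (k - m))ᴴ =
      (-(α : ℂ)) • s (j + k) + s (j + k + 1) := by
  refine toeplitz_hankel_congruence _ _ rfl (hs.conjTranspose_schur1 α)
    (fun j => (-(α : ℂ)) • s j + s (j + 1)) ?_
    (fun j k => (-(α : ℂ)) • s (j + k) + s (j + k + 1)) (fun j => rfl) ?_ j k
  · intro j
    refine Eq.trans ?_ (hs.sum_shiftA_mul_schur1 α j)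
    exact Finset.sum_congr rfl fun l _ => unitCoeff_mul
      (show shiftA (α : ℂ) s 0 * mp (s 0) * schur1 (α : ℂ) s l = schur1 (α : ℂ) s l from
        hs.proj_mul_schur1 _ _) _
  · intro j k
    have hu : ∀ j, unitCoeff (shiftA (α : ℂ) s) (mp (s 0)) (j + 1) =
      shiftA (α : ℂ) s (j + 1) * mp (s 0) := fun j => rfl
    have ha : ∀ j, (-(α : ℂ)) • s j + s (j + 1) = shiftA (α : ℂ) s (j + 1) := fun j => rfl
    simp only [hu, ha, conjTranspose_mul, conjTranspose_mp (hs.herm 0),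
      (hs.isDominated_shiftA α).herm,
      Matrix.mul_assoc]
    rw [add_right_comm j 1 k, ← add_assoc]

lemma congruence_shifted_schur1 (hs : IsDominated s) (α : ℝ) (j k : ℕ) :
    ∑ m ∈ Finset.range (k + 1), (∑ l ∈ Finset.range (j + 1), unitCoeff s (mp (s 0)) (j - l) *
      ((-(α : ℂ)) • schur1 (α : ℂ) s (l + m) + schur1 (α : ℂ) s (l + m + 1))) *
      (unitCoeff s (mp (s 0)) (k - m))ᴴ =
      s (j + k + 2) - s (j + 1) * mp (s 0) * s (k + 1) := by
  refine toeplitz_hankel_congruence _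
    (fun l => (-(α : ℂ)) • schur1 (α : ℂ) s l + schur1 (α : ℂ) s (l + 1)) rfl
    (fun j => by simp [hs.conjTranspose_schur1])
    (fun j => s (j + 2) - s (j + 1) * mp (s 0) * s 1) ?_
    (fun j k => s (j + k + 2) - s (j + 1) * mp (s 0) * s (k + 1)) (fun j => rfl) ?_ j k
  · intro j
    rw [← hs.sum_mul_shifted_schur1 α]
    refine Finset.sum_congr rfl fun l _ => unitCoeff_mul ?_ _
    rw [Matrix.mul_add, Matrix.mul_smul, hs.proj_mul_schur1, hs.proj_mul_schur1]
  · intro j k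
    have hu : ∀ j, unitCoeff s (mp (s 0)) (j + 1) = s (j + 1) * mp (s 0) := fun j => rfl
    simp only [hu, conjTranspose_mul, conjTranspose_mp (hs.herm 0), hs.herm, conjTranspose_sub,
      Matrix.sub_mul, Matrix.mul_sub, Matrix.mul_assoc]
    rw [show j + 1 + k + 2 = j + (k + 1) + 2 by ring]
    abel

lemma Lschur_schur1 (hs : IsDominated s) (α : ℝ) {k : ℕ}
    (h : (hankelMat (fun i => (-(α : ℂ)) • s i + s (i + 1)) k).PosSemidef) :
    Lschur (schur1 (α : ℂ) s) k = Lschur (fun i => (-(α : ℂ)) • s i + s (i + 1)) k := by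
  have h1 : IsLastSchur (fun j m => (-(α : ℂ)) • s (j + m) + s (j + m + 1)) k _ :=
    isLastSchur_Lschur (c := fun i => (-(α : ℂ)) • s i + s (i + 1)) h
  exact ((h1.of_congruence (u := unitCoeff (shiftA (α : ℂ) s) (mp (s 0)))
    (c := schur1 (α : ℂ) s) rfl (hs.congruence_schur1 α)).eq_Lschur
    (hs.conjTranspose_schur1 α)).symm

lemma Lschur_shifted_schur1 (hs : IsDominated s) (α : ℝ) {k : ℕ}
    (h : (hankelMat s (k + 1)).PosSemidef) :
    Lschur (fun i => (-(α : ℂ)) • schur1 (α : ℂ) s i + schur1 (α : ℂ) s (i + 1)) k =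
      Lschur s (k + 1) := by
  have h1 := IsLastSchur.eliminate (W := mp (s 0)) hs.dom_right (isLastSchur_Lschur h)
  have h2 := IsLastSchur.of_congruence (L := Lschur s (k + 1)) (u := unitCoeff s (mp (s 0)))
    (c := fun i => (-(α : ℂ)) • schur1 (α : ℂ) s i + schur1 (α : ℂ) s (i + 1))
    rfl (hs.congruence_shifted_schur1 α) h1
  have h3 : ∀ j, ((-(α : ℂ)) • schur1 (α : ℂ) s j + schur1 (α : ℂ) s (j + 1))ᴴ =
      (-(α : ℂ)) • schur1 (α : ℂ) s j + schur1 (α : ℂ) s (j + 1) :=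
    fun j => by simp [hs.conjTranspose_schur1]
  exact (IsLastSchur.eq_Lschur
    (c := fun i => (-(α : ℂ)) • schur1 (α : ℂ) s i + schur1 (α : ℂ) s (i + 1)) h3 h2).symm

lemma posSemidef_hankelMat_schur1 (hs : IsDominated s) (α : ℝ) {n : ℕ}
    (h : ((-(α : ℂ)) • hankelMat s n + hankelKMat s n).PosSemidef) :
    (hankelMat (schur1 (α : ℂ) s) n).PosSemidef := by
  have h1 := toeplitz_hankel_blockMat (hs.congruence_schur1 α) (n + 1)
  have hu := isUnit_blockMat_lowerToeplitz
    (unitCoeff (shiftA (α : ℂ) s) (mp (s 0))) rfl (n + 1)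
  change (blockMat (n + 1) (n + 1) fun j k => schur1 (α : ℂ) s (j + k)).PosSemidef
  rw [← hu.posSemidef_star_right_conjugate_iff, star_eq_conjTranspose, h1]
  exact h

lemma posSemidef_shifted_schur1 (hs : IsDominated s) (α : ℝ) {n : ℕ}
    (h : (hankelMat s (n + 1)).PosSemidef) :
    ((-(α : ℂ)) • hankelMat (schur1 (α : ℂ) s) n +
      hankelKMat (schur1 (α : ℂ) s) n).PosSemidef := by
  have h1 := toeplitz_hankel_blockMat
    (c := fun i => (-(α : ℂ)) • schur1 (α : ℂ) s i + schur1 (α : ℂ) s (i + 1))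
    (hs.congruence_shifted_schur1 α) (n + 1)
  have hu := isUnit_blockMat_lowerToeplitz (unitCoeff s (mp (s 0))) rfl (n + 1)
  change (blockMat (n + 1) (n + 1) fun j k => (-(α : ℂ)) • schur1 (α : ℂ) s (j + k) +
    schur1 (α : ℂ) s (j + k + 1)).PosSemidef
  rw [← hu.posSemidef_star_right_conjugate_iff, star_eq_conjTranspose, h1]
  have h2 := h.conjTranspose_mul_mul_same (blockMat (n + 2) (n + 1) fun i m =>
    if i = 0 then -(mp (s 0) * s (m + 1)) else if i = m + 1 then 1 else 0)
  convert h2 using 1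
  rw [Matrix.mul_assoc, show hankelMat s (n + 1) = blockMat (n + 2) (n + 2) fun j k => s (j + k)
    from rfl, conjTranspose_blockMat, blockMat_mul, blockMat_mul]
  apply blockMat_congr
  intro j hj k hk
  have key : ∀ i, ∑ m ∈ Finset.range (n + 2), s (i + m) *
      (if m = 0 then -(mp (s 0) * s (k + 1)) else if m = k + 1 then 1 else 0) =
      s (i + k + 1) - s i * mp (s 0) * s (k + 1) := by
    intro i
    rw [Finset.sum_range_succ', Finset.sum_eq_single_of_mem k (Finset.mem_range.mpr hk)]
    · simp [Matrix.mul_assoc, sub_eq_add_neg, add_assoc]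
    · intro m _ hm
      simp [hm]
  simp only [key]
  rw [Finset.sum_range_succ', Finset.sum_eq_single_of_mem j (Finset.mem_range.mpr hj)]
  · simp [hs.dom, show j + 1 + k + 1 = j + k + 2 by ring]
  · intro m _ hm
    simp [hm]

end IsDominated

end DominatedSequences

section Truncation

variable {q : ℕ}

lemma recip_congr {s t : ℕ → Matrix (Fin q) (Fin q) ℂ} {j : ℕ} (h : ∀ i ≤ j, s i = t i) :
    recip s j = recip t j := by
  induction j using Nat.strong_induction_on with
  | _ j ih =>
    cases j with
    | zero => rw [IsDominated.recip_zero, IsDominated.recip_zero, h 0 le_rfl]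
    | succ j =>
      rw [IsDominated.recip_succ, IsDominated.recip_succ, h 0 (by omega)]
      congr 2
      refine Finset.sum_congr rfl fun l hl => ?_
      have hl := Finset.mem_range.mp hl
      rw [h _ (by omega), ih l hl fun i hi => h i (by omega)]

lemma schur1_congr (α : ℂ) {s t : ℕ → Matrix (Fin q) (Fin q) ℂ} {j : ℕ}
    (h : ∀ i ≤ j + 1, s i = t i) : schur1 α s j = schur1 α t j := by
  have h1 : recip (shiftA α s) (j + 1) = recip (shiftA α t) (j + 1) := by
    refine recip_congr fun i hi => ?_
    cases i with
    | zero => exact h 0 (by omega)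
    | succ i => simp only [shiftA, h i (by omega), h (i + 1) hi]
  rw [schur1, schur1, recipA, recipA, h1, h 0 (by omega)]

lemma Lschur_congr {s t : ℕ → Matrix (Fin q) (Fin q) ℂ} {k : ℕ}
    (h : ∀ i ≤ 2 * k, s i = t i) : Lschur s k = Lschur t k := by
  have h1 : ∀ i : Fin k, s (k + i) = t (k + i) := fun i => h _ (by omega)
  have h2 : ∀ i j : Fin k, s (i + j) = t (i + j) := fun i j => h _ (by omega)
  simp only [Lschur, h _ le_rfl, h1, h2]

lemma stieltjesParam_congr (α : ℂ) {s t : ℕ → Matrix (Fin q) (Fin q) ℂ} {j : ℕ}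
    (h : ∀ i ≤ j, s i = t i) : stieltjesParam α s j = stieltjesParam α t j := by
  rw [stieltjesParam, stieltjesParam]
  split_ifs with hj
  · exact Lschur_congr fun i hi => h i (by omega)
  · have hj := Nat.not_even_iff.mp hj
    exact Lschur_congr fun i hi => by rw [h i (by omega), h (i + 1) (by omega)]

lemma mul_eq_zero_of_posSemidef_blockMat {n : ℕ} {h : ℕ → ℕ → Matrix (Fin q) (Fin q) ℂ}
    (hH : (blockMat n n h).PosSemidef) {i j : ℕ} (hi : i < n) (hj : j < n)
    {B : Matrix (Fin q) (Fin q) ℂ} (hB : h i i * B = 0) : h j i * B = 0 := by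
  have := hH.submatrix_mul_eq_zero (fun x : Fin q => ((⟨i, hi⟩, x) : Fin n × Fin q)) B hB
  ext a b
  exact congrFun (congrFun this (⟨j, hj⟩, a)) b

lemma posSemidef_blockMat_conj {n : ℕ} {h : ℕ → ℕ → Matrix (Fin q) (Fin q) ℂ}
    (hH : (blockMat n n h).PosSemidef) {P : Matrix (Fin q) (Fin q) ℂ} (hP : Pᴴ = P) :
    (blockMat n n fun j k => P * h j k * P).PosSemidef := by
  have h1 := hH.mul_mul_conjTranspose_same (blockMat n n fun i j => if i = j then P else 0)
  convert h1 using 1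
  rw [conjTranspose_blockMat, blockMat_mul, blockMat_mul]
  refine blockMat_congr fun j hj k hk => ?_
  rw [Finset.sum_eq_single_of_mem k (Finset.mem_range.mpr hk) (fun m _ hm => by simp [hm.symm]),
    Finset.sum_eq_single_of_mem j (Finset.mem_range.mpr hj) (fun m _ hm => by simp [hm.symm])]
  simp [hP]

end Truncation

namespace Kgg

variable {q : ℕ} {α : ℝ} {m : ℕ} {s : ℕ → Matrix (Fin q) (Fin q) ℂ}

lemma posSemidef (h : Kgg α (m : ℕ∞) s) {n : ℕ} (hn : 2 * n ≤ m) :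
    (blockMat (n + 1) (n + 1) fun j k => s (j + k)).PosSemidef :=
  h.1 n (by exact_mod_cast hn)

lemma posSemidef_shifted (h : Kgg α (m : ℕ∞) s) {n : ℕ} (hn : 2 * n + 1 ≤ m) :
    (blockMat (n + 1) (n + 1) fun j k =>
      (-(α : ℂ)) • s (j + k) + s (j + k + 1)).PosSemidef :=
  h.2 n (by exact_mod_cast hn)

lemma conjTranspose_eq (h : Kgg α (m : ℕ∞) s) {j : ℕ} (hj : j ≤ m) : (s j)ᴴ = s j := by
  have heven : ∀ n, 2 * n ≤ m → (s (n + n))ᴴ = s (n + n) := fun n hn =>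
    blockMat_apply_eq (f := fun j k => (s (k + j))ᴴ) (g := fun j k => s (j + k))
      (h.posSemidef hn).isHermitian (Nat.lt_succ_self n) (Nat.lt_succ_self n)
  obtain ⟨n, rfl | rfl⟩ := Nat.even_or_odd' j
  · rw [two_mul]
    exact heven n hj
  · have h1 := blockMat_apply_eq (f := fun j k => ((-(α : ℂ)) • s (k + j) + s (k + j + 1))ᴴ)
      (g := fun j k => (-(α : ℂ)) • s (j + k) + s (j + k + 1))
      (h.posSemidef_shifted hj).isHermitian (Nat.lt_succ_self n) (Nat.lt_succ_self n)
    simp only [conjTranspose_add, conjTranspose_smul, heven n (by omega)] at h1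
    rw [two_mul]
    simpa using h1

lemma mul_eq_zero (h : Kgg α ((m + 1 : ℕ) : ℕ∞) s) {B : Matrix (Fin q) (Fin q) ℂ}
    (hB : s 0 * B = 0) {j : ℕ} (hj : j ≤ m) : s j * B = 0 := by
  induction j using Nat.strong_induction_on with
  | _ j ih =>
    obtain ⟨n, rfl | rfl⟩ := Nat.even_or_odd' j
    · cases n with
      | zero => exact hB
      | succ n =>
        have h0 := ih (2 * n) (by omega) (by omega)
        have h1 := ih (2 * n + 1) (by omega) (by omega)
        have h2 := mul_eq_zero_of_posSemidef_blockMat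
          (h.posSemidef_shifted (n := n + 1) (by omega)) (i := n) (j := n + 1)
          (by omega) (by omega) (B := B) (by
            rw [← two_mul, Matrix.add_mul, Matrix.smul_mul, h0, h1, smul_zero, add_zero])
        rw [show n + 1 + n = 2 * n + 1 by ring, Matrix.add_mul, Matrix.smul_mul, h1, smul_zero,
          zero_add] at h2
        exact h2
    · have h2 := mul_eq_zero_of_posSemidef_blockMat
        (h.posSemidef (n := n + 1) (by omega)) (i := n) (j := n + 1)
        (by omega) (by omega) (B := B) (by rw [← two_mul]; exact ih _ (by omega) (by omega))
      rwa [show n + 1 + n = 2 * n + 1 by ring] at h2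

lemma exists_isDominated (h : Kgg α ((m + 1 : ℕ) : ℕ∞) s) :
    ∃ t : ℕ → Matrix (Fin q) (Fin q) ℂ, (∀ j ≤ m, t j = s j) ∧ IsDominated t ∧
      Kgg α ((m + 1 : ℕ) : ℕ∞) t := by
  have h0 := h.conjTranspose_eq (Nat.zero_le _)
  obtain ⟨hP1, -, hPh, -⟩ := isMP_mp h0
  set P := s 0 * mp (s 0) with hP
  have hPP : P * P = P := by rw [hP, ← Matrix.mul_assoc, hP1]
  have hright : ∀ j ≤ m, s j * P = s j := by
    intro j hj
    have := h.mul_eq_zero (B := 1 - P) (by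
      rw [Matrix.mul_sub, Matrix.mul_one, hP, mul_mp_comm h0, ← Matrix.mul_assoc, hP1,
        sub_self]) hj
    rw [Matrix.mul_sub, Matrix.mul_one, sub_eq_zero] at this
    exact this.symm
  have hleft : ∀ j ≤ m, P * s j = s j := by
    intro j hj
    have := congrArg conjTranspose (hright j hj)
    rwa [conjTranspose_mul, hPh, h.conjTranspose_eq (by omega)] at this
  set t : ℕ → Matrix (Fin q) (Fin q) ℂ := fun j => if j ≤ m + 1 then P * s j * P else 0 with ht
  have hts : ∀ j ≤ m, t j = s j := by
    intro j hj
    simp only [ht]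
    rw [if_pos (by omega), hleft j hj, hright j hj]
  refine ⟨t, hts, ⟨fun j => ?_, fun j => ?_⟩, fun n hn => ?_, fun n hn => ?_⟩
  · simp only [ht]
    split_ifs with hj
    · rw [conjTranspose_mul (P * s j) P, conjTranspose_mul P (s j), hPh, h.conjTranspose_eq hj,
        ← Matrix.mul_assoc P (s j)]
    · exact conjTranspose_zero
  · rw [hts 0 (Nat.zero_le _), ← hP]
    simp only [ht]
    split_ifs with hj
    · rw [← Matrix.mul_assoc P (P * s j), ← Matrix.mul_assoc P P, hPP]
    · exact Matrix.mul_zero _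
  · have hn' : 2 * n ≤ m + 1 := by exact_mod_cast hn
    have h1 := posSemidef_blockMat_conj (h.posSemidef hn') hPh
    convert h1 using 1
    refine blockMat_congr (f := fun j k => t (j + k)) fun j hj k hk => ?_
    simp only [ht]
    rw [if_pos (by omega)]
  · have hn' : 2 * n + 1 ≤ m + 1 := by exact_mod_cast hn
    have h1 := posSemidef_blockMat_conj (h.posSemidef_shifted hn') hPh
    convert h1 using 1
    refine blockMat_congr (f := fun j k => (-(α : ℂ)) • t (j + k) + t (j + k + 1))
      fun j hj k hk => ?_
    simp only [ht]
    rw [if_pos (by omega), if_pos (by omega)]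
    simp only [Matrix.mul_add, Matrix.add_mul, Matrix.mul_smul, Matrix.smul_mul]

lemma schur1 (h : Kgg α ((m + 1 : ℕ) : ℕ∞) s) (hs : IsDominated s) :
    Kgg α (m : ℕ∞) (schur1 (α : ℂ) s) := by
  refine ⟨fun n hn => hs.posSemidef_hankelMat_schur1 α (h.2 n ?_),
    fun n hn => hs.posSemidef_shifted_schur1 α (h.1 (n + 1) ?_)⟩
  · have : 2 * n ≤ m := by exact_mod_cast hn
    exact_mod_cast (by omega : 2 * n + 1 ≤ m + 1)
  · have : 2 * n + 1 ≤ m := by exact_mod_cast hn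
    exact_mod_cast (by omega : 2 * (n + 1) ≤ m + 1)

lemma stieltjesParam_schur1 (h : Kgg α ((m + 1 : ℕ) : ℕ∞) s) (hs : IsDominated s) :
    stieltjesParam (α : ℂ) (_root_.schur1 (α : ℂ) s) m = stieltjesParam (α : ℂ) s (m + 1) := by
  rw [stieltjesParam, stieltjesParam]
  obtain ⟨k, rfl | rfl⟩ := Nat.even_or_odd' m
  · rw [if_pos (even_two_mul k), if_neg (by simp), show 2 * k / 2 = k by omega,
      show (2 * k + 1) / 2 = k by omega]
    exact hs.Lschur_schur1 α (h.posSemidef_shifted le_rfl)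
  · rw [if_neg (by simp), if_pos (by use k + 1; ring), show (2 * k + 1) / 2 = k by omega,
      show (2 * k + 1 + 1) / 2 = k + 1 by omega]
    exact hs.Lschur_shifted_schur1 α (h.posSemidef (n := k + 1) (by omega))

end Kgg

lemma iterate_schur1_zero {q : ℕ} (α : ℝ) (m : ℕ) (s : ℕ → Matrix (Fin q) (Fin q) ℂ)
    (hs : ∃ t : ℕ → Matrix (Fin q) (Fin q) ℂ,
      (∀ j ≤ m, t j = s j) ∧ Kgg α ((m + 1 : ℕ) : ℕ∞) t) :
    (schur1 (α : ℂ))^[m] s 0 = stieltjesParam (α : ℂ) s m := by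
  induction m generalizing s with
  | zero =>
    ext a b
    simp [stieltjesParam, Lschur, mul_apply]
  | succ m ih =>
    obtain ⟨t', ht's, ht'⟩ := hs
    obtain ⟨t, htt', hdom, ht⟩ := ht'.exists_isDominated
    have hts : ∀ j ≤ m + 1, t j = s j := fun j hj => (htt' j hj).trans (ht's j hj)
    have hagree : ∀ j ≤ m, schur1 (α : ℂ) t j = schur1 (α : ℂ) s j := fun j hj =>
      schur1_congr _ fun i hi => hts i (by omega)
    have ht1 : Kgg α ((m + 1 : ℕ) : ℕ∞) t :=
      ⟨fun n hn => ht.1 n (hn.trans (by exact_mod_cast Nat.le_succ _)),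
        fun n hn => ht.2 n (hn.trans (by exact_mod_cast Nat.le_succ _))⟩
    rw [Function.iterate_succ_apply, ih _ ⟨schur1 (α : ℂ) t, hagree, ht.schur1 hdom⟩,
      ← stieltjesParam_congr _ hagree, ht1.stieltjesParam_schur1 hdom,
      stieltjesParam_congr _ hts]

/-- Theorem 9.2: for an α-Stieltjes right-nonnegative definite extendable sequence,
    the zeroth entries of the iterated α-Schur transforms give exactly the right
    α-Stieltjes parametrization. -/
theorem stmt12 {q : ℕ} (α : ℝ) (κ : ℕ∞)
    (s : ℕ → Matrix (Fin q) (Fin q) ℂ) (hs : KggE α κ s) :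
    ∀ j : ℕ, (j : ℕ∞) ≤ κ →
      (schur1 (α : ℂ))^[j] s 0 = stieltjesParam (α : ℂ) s j := by
  intro j hj
  exact iterate_schur1_zero α j s (hs j hj)
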